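/- The set G equipped with the affine feedback product c ⋆ d := (c ⊲ d) ⊙ d is a group with identity element e = (𝟙, 0); explicitly, ⋆ is associative with unit e and every element of G has a two-sided ⋆-inverse in G. -/

import Mathlib

open scoped Classical

/-!  Common setup: noncommutative formal power series ℝ⟨⟨X⟩⟩ over the
alphabet X = {x₀, x₁}.  Words are encoded as lists over `Fin 2`
(the letter `0` is x₀ and `1` is x₁); a series is a function from words
to ℝ, recording its coefficients. -/

/-- Words over the alphabet X = {x₀, x₁}. -/
abbrev Word : Type := List (Fin 2)

/-- Noncommutative formal power series ℝ⟨⟨X⟩⟩. -/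
abbrev Ser : Type := Word → ℝ

/-- The series 𝟙 (the empty word). -/
def one1 : Ser := fun w => if w = [] then 1 else 0

/-- A single word η regarded as a series. -/
def mono (η : Word) : Ser := fun w => if w = η then 1 else 0

/-- Left concatenation of a series by the letter `x_i`. -/
def lc (i : Fin 2) (c : Ser) : Ser := fun w =>
  match w with
  | [] => 0
  | j :: u => if j = i then c u else 0

/-- Auxiliary recursion computing the coefficient of a word `w` in `c ⧢ d`:
`(c ⧢ d)(𝟙) = c(𝟙) d(𝟙)` and
`(c ⧢ d)(x_i w) = ((x_i⁻¹ c) ⧢ d)(w) + (c ⧢ (x_i⁻¹ d))(w)`,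
where `x_i⁻¹` is the left shift.  This dual recursion is exactly the
bilinear extension of the inductive shuffle of words
`(x_i ξ) ⧢ (x_j η) = x_i (ξ ⧢ x_j η) + x_j (x_i ξ ⧢ η)`, `𝟙 ⧢ η = η ⧢ 𝟙 = η`. -/
def shAux : Word → Ser → Ser → ℝ
  | [], c, d => c [] * d []
  | i :: w, c, d => shAux w (fun u => c (i :: u)) d + shAux w c (fun u => d (i :: u))

/-- The shuffle product `⧢` on ℝ⟨⟨X⟩⟩. -/
def sh (c d : Ser) : Ser := fun w => shAux w c d

/-- Shuffle powers `c^{⧢ k}`. -/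
def shPow (c : Ser) : ℕ → Ser
  | 0 => one1
  | k + 1 => sh c (shPow c k)

/-- The shuffle inverse `c^{⧢ -1} = Σ_{k ≥ 0} (𝟙 - c)^{⧢ k}`.
When `c(𝟙) = 1` the sum is locally finite (for each word only finitely many
terms are nonzero) and `∑'` returns it. -/
noncomputable def shInv (c : Ser) : Ser := fun w => ∑' k : ℕ, shPow (one1 - c) k w

/-- Composition product restricted to words: `𝟙 ∘ d = 𝟙`,
`(x₀ η) ∘ d = x₀ (η ∘ d)`, `(x₁ η) ∘ d = x₀ (d ⧢ (η ∘ d))`. -/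
def wordComp : Word → Ser → Ser
  | [], _ => one1
  | i :: η, d => if i = 0 then lc 0 (wordComp η d) else lc 0 (sh d (wordComp η d))

/-- The composition product `c ∘ d = Σ_η c(η) (η ∘ d)`.  For each fixed word
only finitely many terms are nonzero, and `∑'` returns the sum. -/
noncomputable def comp (c d : Ser) : Ser := fun w => ∑' η : Word, c η * wordComp η d w

/-- Membership in the set `G`: pairs `(d₁, d₂)` with `d₁(𝟙) = 1`. -/
def inG (d : Ser × Ser) : Prop := d.1 [] = 1

/-- Mixed composition product restricted to words: `𝟙 ◁ d = 𝟙`,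
`(x₀ η) ◁ d = x₀ (η ◁ d)`,
`(x₁ η) ◁ d = x₁ (d₁ ⧢ (η ◁ d)) + x₀ (d₂ ⧢ (η ◁ d))`. -/
def wordMComp : Word → Ser × Ser → Ser
  | [], _ => one1
  | i :: η, d =>
      if i = 0 then lc 0 (wordMComp η d)
      else lc 1 (sh d.1 (wordMComp η d)) + lc 0 (sh d.2 (wordMComp η d))

/-- The mixed composition product `c ◁ d = Σ_η c(η) (η ◁ d)`. -/
noncomputable def mcomp (c : Ser) (d : Ser × Ser) : Ser :=
  fun w => ∑' η : Word, c η * wordMComp η d w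

/-- Componentwise mixed composition `c ⊲ d = (c₁ ◁ d, c₂ ◁ d)`. -/
noncomputable def tri (c d : Ser × Ser) : Ser × Ser := (mcomp c.1 d, mcomp c.2 d)

/-- Componentwise composition `d ∘̄ c = (d₁ ∘ c, d₂ ∘ c)`. -/
noncomputable def bcomp (d : Ser × Ser) (c : Ser) : Ser × Ser := (comp d.1 c, comp d.2 c)

/-- The group product `⊙` on `G`:
`(c₁, c₂) ⊙ (d₁, d₂) = (c₁ ⧢ d₁, c₂ + d₂ ⧢ c₁)`. -/
def odot (c d : Ser × Ser) : Ser × Ser := (sh c.1 d.1, c.2 + sh d.2 c.1)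

/-- The identity element `e = (𝟙, 0)`. -/
def eG : Ser × Ser := (one1, 0)

/-- The `⊙`-inverse `c^{⊙ -1} = (c₁^{⧢ -1}, -(c₁^{⧢ -1} ⧢ c₂))`. -/
noncomputable def odotInv (c : Ser × Ser) : Ser × Ser :=
  (shInv c.1, -(sh (shInv c.1) c.2))

/-- The affine feedback group product `c ⋆ d = (c ⊲ d) ⊙ d` on `G`. -/
noncomputable def star (c d : Ser × Ser) : Ser × Ser := odot (tri c d) d

/-- The `⋆`-inverse of an element of `G` (defined via choice; for an element
of the group `(G, ⋆)` it is the unique two-sided `⋆`-inverse). -/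
noncomputable def starInv (x : Ser × Ser) : Ser × Ser :=
  if h : ∃ y : Ser × Ser, inG y ∧ star x y = eG ∧ star y x = eG then h.choose else x

/-- The affine feedback product `c @ d = c ◁ ((d^{⊙ -1}) ∘̄ c)^{⋆ -1}`. -/
noncomputable def atp (c : Ser) (d : Ser × Ser) : Ser :=
  mcomp c (starInv (bcomp (odotInv d) c))

/-- Membership in ℝ[[x₀]]: series vanishing on every word containing x₁. -/
def inRx0 (c : Ser) : Prop := ∀ w : Word, (1 : Fin 2) ∈ w → c w = 0

/-- The left shift `x_i⁻¹ c` of a series. -/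
def shift (i : Fin 2) (c : Ser) : Ser := fun w => c (i :: w)

/-- Two series agree on all words of length less than `n`. -/
def EqUpTo (n : ℕ) (f g : Ser) : Prop := ∀ w : Word, w.length < n → f w = g w

section EqUpTo

lemma eqUpTo_zero (f g : Ser) : EqUpTo 0 f g := fun _ h => absurd h (Nat.not_lt_zero _)

lemma EqUpTo.shift {n : ℕ} {f g : Ser} (h : EqUpTo (n + 1) f g) (i : Fin 2) :
    EqUpTo n (shift i f) (shift i g) :=
  fun w hw => h (i :: w) (by simpa using hw)

lemma EqUpTo.add {n : ℕ} {f f' g g' : Ser} (hf : EqUpTo n f f') (hg : EqUpTo n g g') :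
    EqUpTo n (f + g) (f' + g') :=
  fun w hw => by simp [hf w hw, hg w hw]

lemma EqUpTo.succ {n : ℕ} {f g : Ser} (h : f [] = g [])
    (h0 : EqUpTo n (_root_.shift 0 f) (_root_.shift 0 g))
    (h1 : EqUpTo n (_root_.shift 1 f) (_root_.shift 1 g)) : EqUpTo (n + 1) f g
  | [], _ => h
  | i :: w, hw => by
    have hw' : w.length < n := by simpa using hw
    fin_cases i
    · exact h0 w hw'
    · exact h1 w hw'

lemma eq_of_eqUpTo {f g : Ser} (h : ∀ n, EqUpTo n f g) : f = g :=
  funext fun w => h (w.length + 1) w (Nat.lt_succ_self _)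

end EqUpTo

section Shuffle

lemma shift_add (i : Fin 2) (c d : Ser) : shift i (c + d) = shift i c + shift i d := rfl

lemma shift_one1 (i : Fin 2) : shift i one1 = 0 := by
  ext w; simp [shift, one1]

lemma sh_nil (c d : Ser) : sh c d [] = c [] * d [] := rfl

lemma sh_cons (c d : Ser) (i : Fin 2) (w : Word) :
    sh c d (i :: w) = sh (shift i c) d w + sh c (shift i d) w := rfl

lemma shift_sh (c d : Ser) (i : Fin 2) :
    shift i (sh c d) = sh (shift i c) d + sh c (shift i d) := rfl

lemma sh_comm (c d : Ser) : sh c d = sh d c := by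
  ext w
  induction w generalizing c d with
  | nil => simp [sh_nil, mul_comm]
  | cons i w ih => rw [sh_cons, sh_cons, ih, ih c, add_comm]

lemma sh_add (c d e : Ser) : sh c (d + e) = sh c d + sh c e := by
  ext w
  induction w generalizing c d e with
  | nil => simp [sh_nil, mul_add]
  | cons i w ih =>
    simp only [Pi.add_apply] at ih
    simp only [Pi.add_apply, sh_cons, shift_add, ih]
    ring

lemma add_sh (c d e : Ser) : sh (c + d) e = sh c e + sh d e := by
  rw [sh_comm, sh_add, sh_comm e, sh_comm e]

lemma sh_smul (a : ℝ) (c d : Ser) : sh c (a • d) = a • sh c d := by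
  ext w
  induction w generalizing c d with
  | nil => simp [sh_nil, mul_left_comm]
  | cons i w ih =>
    have hs : shift i (a • d) = a • shift i d := rfl
    simp only [Pi.smul_apply, smul_eq_mul] at ih
    simp only [Pi.smul_apply, smul_eq_mul, sh_cons, hs, ih]
    ring

lemma sh_zero (c : Ser) : sh c 0 = 0 := by
  simpa using sh_smul 0 c 0

lemma zero_sh (c : Ser) : sh 0 c = 0 := by
  rw [sh_comm, sh_zero]

lemma sh_neg (c d : Ser) : sh c (-d) = -sh c d := by
  simpa using sh_smul (-1) c d

lemma one1_sh (c : Ser) : sh one1 c = c := by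
  ext w
  induction w generalizing c with
  | nil => simp [sh_nil, one1]
  | cons i w ih => rw [sh_cons, ih, shift_one1, zero_sh]; simp [shift]

lemma sh_one1 (c : Ser) : sh c one1 = c := by
  rw [sh_comm, one1_sh]

lemma sh_assoc (c d e : Ser) : sh (sh c d) e = sh c (sh d e) := by
  ext w
  induction w generalizing c d e with
  | nil => simp [sh_nil, mul_assoc]
  | cons i w ih =>
    simp only [sh_cons, shift_sh, add_sh, sh_add, Pi.add_apply, ih]
    ring

lemma sh_left_comm (c d e : Ser) : sh c (sh d e) = sh d (sh c e) := by
  rw [← sh_assoc, sh_comm c d, sh_assoc]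

lemma EqUpTo.sh {n : ℕ} {f g : Ser} (h : EqUpTo n f g) (c : Ser) :
    EqUpTo n (sh c f) (sh c g) := by
  intro w
  induction w generalizing c f g n with
  | nil => intro hw; rw [sh_nil, sh_nil, h [] hw]
  | cons i w ih =>
    intro hw
    obtain ⟨m, rfl⟩ : ∃ m, n = m + 1 := ⟨n - 1, by grind⟩
    have hw' : w.length < m := by simpa using hw
    rw [sh_cons, sh_cons, ih h _ (by omega), ih (h.shift i) _ hw']

/-- Shuffling with a series without constant term is contracting. -/
lemma EqUpTo.sh_succ {n : ℕ} {f g : Ser} (h : EqUpTo n f g) {c : Ser} (hc : c [] = 0) :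
    EqUpTo (n + 1) (_root_.sh c f) (_root_.sh c g) := by
  intro w
  induction w generalizing f g n with
  | nil => intro _; simp [sh_nil, hc]
  | cons i w ih =>
    intro hw
    obtain ⟨m, rfl⟩ : ∃ m, n = m + 1 := ⟨n - 1, by grind⟩
    have hw' : w.length < m + 1 := by simpa using hw
    rw [sh_cons, sh_cons, h.sh _ w hw', ih (h.shift i) hw']

lemma exists_fixedPoint_of_contracting {T : Ser → Ser}
    (hT : ∀ n f g, EqUpTo n f g → EqUpTo (n + 1) (T f) (T g)) : ∃ f, T f = f := by
  have hstep : ∀ n k, EqUpTo n (T^[n] 0) (T^[n + k] 0) := by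
    intro n
    induction n with
    | zero => exact fun k => eqUpTo_zero _ _
    | succ n ih =>
      intro k
      rw [Nat.add_right_comm, Function.iterate_succ_apply', Function.iterate_succ_apply']
      exact hT _ _ _ (ih k)
  let f : Ser := fun w => T^[w.length + 1] 0 w
  have hf : ∀ n, EqUpTo n f (T^[n] 0) := by
    intro n w hw
    obtain ⟨k, rfl⟩ := Nat.exists_eq_add_of_lt hw
    have := hstep (w.length + 1) k w (Nat.lt_succ_self _)
    rwa [Nat.add_right_comm] at this
  refine ⟨f, eq_of_eqUpTo fun n w hw => ?_⟩
  rw [hT n _ _ (hf n) w (by omega), ← Function.iterate_succ_apply' T n,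
    hf (n + 1) w (by omega)]

lemma exists_sh_inverse {c : Ser} (hc : c [] = 1) : ∃ s, sh c s = one1 := by
  obtain ⟨s, hs⟩ := exists_fixedPoint_of_contracting (T := fun s => one1 + sh (one1 + -c) s)
    fun n f g h => EqUpTo.add (fun _ _ => rfl) (h.sh_succ (by simp [hc, one1]))
  refine ⟨s, ?_⟩
  rw [add_sh, one1_sh, sh_comm (-c), sh_neg, sh_comm s] at hs
  have : one1 - sh c s = 0 := by
    rw [← sub_eq_zero] at hs
    rw [← hs]; abel
  exact (sub_eq_zero.mp this).symm

lemma hasSum_sh {ι : Type*} {g : ι → Ser} {s : Ser} (h : ∀ u, HasSum (fun η => g η u) (s u))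
    (c : Ser) (w : Word) : HasSum (fun η => sh c (g η) w) (sh c s w) := by
  induction w generalizing c g s with
  | nil => exact (h []).mul_left _
  | cons i w ih => exact (ih h _).add (ih (fun u => h (i :: u)) _)

end Shuffle

section MixedComposition

lemma wordMComp_zero_cons (η : Word) (d : Ser × Ser) :
    wordMComp (0 :: η) d = lc 0 (wordMComp η d) := by
  simp [wordMComp]

lemma wordMComp_one_cons (η : Word) (d : Ser × Ser) :
    wordMComp (1 :: η) d = lc 1 (sh d.1 (wordMComp η d)) + lc 0 (sh d.2 (wordMComp η d)) := by
  simp [wordMComp]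

lemma EqUpTo.lc_zero {n : ℕ} {f : Ser} (h : EqUpTo n f 0) (i : Fin 2) :
    EqUpTo (n + 1) (lc i f) 0
  | [], _ => rfl
  | j :: w, hw => by
    have := h w (by simpa using hw)
    simp_all [lc]

lemma wordMComp_eqUpTo_zero (η : Word) (d : Ser × Ser) :
    EqUpTo η.length (wordMComp η d) 0 := by
  induction η with
  | nil => exact eqUpTo_zero _ _
  | cons i η ih =>
    have hsh (c : Ser) : EqUpTo η.length (sh c (wordMComp η d)) 0 := by
      simpa [sh_zero] using ih.sh c
    fin_cases i
    · simpa [wordMComp_zero_cons] using ih.lc_zero 0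
    · simpa [wordMComp_one_cons] using ((hsh d.1).lc_zero 1).add ((hsh d.2).lc_zero 0)

lemma hasSum_mcomp (c : Ser) (d : Ser × Ser) (w : Word) :
    HasSum (fun η => c η * wordMComp η d w) (mcomp c d w) := by
  refine (summable_of_hasFiniteSupport ?_).hasSum
  refine (List.finite_length_le (Fin 2) w.length).subset fun η hη => ?_
  by_contra hlt
  exact hη (by simp [wordMComp_eqUpTo_zero η d w (by simpa using hlt)])

lemma hasSum_sh_mcomp (e c : Ser) (d : Ser × Ser) (w : Word) :
    HasSum (fun η => c η * sh e (wordMComp η d) w) (sh e (mcomp c d) w) := by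
  simpa [sh_smul] using
    hasSum_sh (g := fun η => c η • wordMComp η d) (fun u => hasSum_mcomp c d u) e w

lemma hasSum_word {f : Word → ℝ} {a b : ℝ} (h0 : HasSum (fun η => f (0 :: η)) a)
    (h1 : HasSum (fun η => f (1 :: η)) b) : HasSum f (f [] + a + b) := by
  have hinj (i : Fin 2) : Function.Injective (fun η : Word => i :: η) := List.cons_injective
  have hsum := ((hasSum_ite_eq ([] : Word) (f [])).add
    ((hasSum_extend_zero (hinj 0)).2 h0)).add ((hasSum_extend_zero (hinj 1)).2 h1)
  convert hsum using 1
  ext η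
  rcases η with _ | ⟨i, η⟩
  · simp [Function.extend]
  · fin_cases i <;> simp [Function.extend]

lemma mcomp_nil (c : Ser) (d : Ser × Ser) : mcomp c d [] = c [] := by
  refine (hasSum_mcomp c d []).unique ?_
  have h := hasSum_word (f := fun η => c η * wordMComp η d []) (a := 0) (b := 0)
    (by simp [wordMComp_zero_cons, lc, hasSum_zero])
    (by simp [wordMComp_one_cons, lc, hasSum_zero])
  simpa [wordMComp, one1] using h

lemma shift_zero_mcomp (c : Ser) (d : Ser × Ser) :
    shift 0 (mcomp c d) = mcomp (shift 0 c) d + sh d.2 (mcomp (shift 1 c) d) := by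
  ext w
  refine (hasSum_mcomp c d (0 :: w)).unique ?_
  have h := hasSum_word (f := fun η => c η * wordMComp η d (0 :: w))
    (by simpa [wordMComp_zero_cons, lc, shift] using hasSum_mcomp (shift 0 c) d w)
    (by simpa [wordMComp_one_cons, lc, shift] using hasSum_sh_mcomp d.2 (shift 1 c) d w)
  simpa [wordMComp, one1] using h

lemma shift_one_mcomp (c : Ser) (d : Ser × Ser) :
    shift 1 (mcomp c d) = sh d.1 (mcomp (shift 1 c) d) := by
  ext w
  refine (hasSum_mcomp c d (1 :: w)).unique ?_
  have h := hasSum_word (f := fun η => c η * wordMComp η d (1 :: w)) (a := 0)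
    (by simp [wordMComp_zero_cons, lc, hasSum_zero])
    (by simpa [wordMComp_one_cons, lc, shift] using hasSum_sh_mcomp d.1 (shift 1 c) d w)
  simpa [wordMComp, one1] using h

lemma mcomp_add (a b : Ser) (d : Ser × Ser) : mcomp (a + b) d = mcomp a d + mcomp b d := by
  ext w
  refine (hasSum_mcomp (a + b) d w).unique ?_
  simpa [add_mul] using (hasSum_mcomp a d w).add (hasSum_mcomp b d w)

lemma zero_mcomp (d : Ser × Ser) : mcomp 0 d = 0 := by
  ext w; simp [mcomp]

lemma one1_mcomp (d : Ser × Ser) : mcomp one1 d = one1 := by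
  refine eq_of_eqUpTo fun n => ?_
  rcases n with _ | n
  · exact eqUpTo_zero _ _
  · refine EqUpTo.succ (mcomp_nil _ _) ?_ ?_ <;>
      simp [shift_zero_mcomp, shift_one_mcomp, shift_one1, zero_mcomp, sh_zero, EqUpTo]

lemma mcomp_eG (c : Ser) : mcomp c eG = c := by
  refine eq_of_eqUpTo fun n => ?_
  induction n generalizing c with
  | zero => exact eqUpTo_zero _ _
  | succ n ih =>
    refine EqUpTo.succ (mcomp_nil _ _) ?_ ?_
    · simpa [shift_zero_mcomp, eG, zero_sh] using ih (shift 0 c)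
    · simpa [shift_one_mcomp, eG, one1_sh] using ih (shift 1 c)

lemma mcomp_sh (a b : Ser) (d : Ser × Ser) :
    mcomp (sh a b) d = sh (mcomp a d) (mcomp b d) := by
  refine eq_of_eqUpTo fun n => ?_
  induction n generalizing a b with
  | zero => exact eqUpTo_zero _ _
  | succ n ih =>
    have key (i : Fin 2) : EqUpTo n (mcomp (shift i (sh a b)) d)
        (sh (mcomp (shift i a) d) (mcomp b d) + sh (mcomp a d) (mcomp (shift i b) d)) := by
      rw [shift_sh, mcomp_add]
      exact (ih _ _).add (ih _ _)
    refine EqUpTo.succ (by simp [sh_nil, mcomp_nil]) ?_ ?_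
    · rw [shift_zero_mcomp, shift_sh (mcomp a d), shift_zero_mcomp, shift_zero_mcomp]
      convert (key 0).add ((key 1).sh d.2) using 1
      simp only [sh_add, add_sh, sh_assoc, sh_left_comm d.2]
      abel
    · rw [shift_one_mcomp, shift_sh (mcomp a d), shift_one_mcomp, shift_one_mcomp]
      convert (key 1).sh d.1 using 1
      simp only [sh_add, sh_assoc, sh_left_comm d.1]

lemma star_def (c d : Ser × Ser) :
    star c d = (sh (mcomp c.1 d) d.1, mcomp c.2 d + sh d.2 (mcomp c.1 d)) := rfl

lemma mcomp_mcomp (c : Ser) (d f : Ser × Ser) :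
    mcomp (mcomp c d) f = mcomp c (star d f) := by
  refine eq_of_eqUpTo fun n => ?_
  induction n generalizing c with
  | zero => exact eqUpTo_zero _ _
  | succ n ih =>
    refine EqUpTo.succ (by simp [mcomp_nil]) ?_ ?_
    · simp only [shift_zero_mcomp, shift_one_mcomp, mcomp_add, mcomp_sh]
      convert (ih (shift 0 c)).add ((ih (shift 1 c)).sh (star d f).2) using 1
      simp only [star_def, add_sh, sh_assoc]
      abel
    · simp only [shift_one_mcomp, mcomp_sh]
      convert (ih (shift 1 c)).sh (star d f).1 using 1
      simp only [star_def, sh_assoc, sh_left_comm f.1]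

/-- The preimage of `s` under `a ↦ a ◁ d`, where `r` is the shuffle inverse of `d₁`. -/
def mcompPreimage (r : Ser) (d : Ser × Ser) : Ser → Word → ℝ
  | s, [] => s []
  | s, i :: w =>
    if i = 0 then mcompPreimage r d (shift 0 s + -sh d.2 (sh r (shift 1 s))) w
    else mcompPreimage r d (sh r (shift 1 s)) w

lemma mcomp_mcompPreimage {r : Ser} {d : Ser × Ser} (hr : sh d.1 r = one1) (s : Ser) :
    mcomp (mcompPreimage r d s) d = s := by
  refine eq_of_eqUpTo fun n => ?_
  induction n generalizing s with
  | zero => exact eqUpTo_zero _ _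
  | succ n ih =>
    have h0 : shift 0 (mcompPreimage r d s) =
        mcompPreimage r d (shift 0 s + -sh d.2 (sh r (shift 1 s))) := by
      ext w; simp [shift, mcompPreimage]
    have h1 : shift 1 (mcompPreimage r d s) = mcompPreimage r d (sh r (shift 1 s)) := by
      ext w; simp [shift, mcompPreimage]
    refine EqUpTo.succ (by simp [mcomp_nil, mcompPreimage]) ?_ ?_
    · rw [shift_zero_mcomp, h0, h1]
      convert (ih _).add ((ih _).sh d.2) using 1
      abel
    · rw [shift_one_mcomp, h1]
      convert (ih _).sh d.1 using 1
      rw [← sh_assoc, hr, one1_sh]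

end MixedComposition

section Group

lemma inG_star {c d : Ser × Ser} (hc : inG c) (hd : inG d) : inG (star c d) := by
  simp_all [inG, star_def, sh_nil, mcomp_nil]

lemma inG_eG : inG eG := by simp [inG, eG, one1]

lemma star_assoc (c d f : Ser × Ser) : star (star c d) f = star c (star d f) := by
  rw [star_def (star c d) f, star_def c (star d f), ← mcomp_mcomp, ← mcomp_mcomp]
  simp only [star_def, mcomp_add, mcomp_sh, add_sh, sh_assoc, sh_comm (mcomp d.1 f), add_assoc]

lemma eG_star (c : Ser × Ser) : star eG c = c := by
  simp [star_def, eG, one1_mcomp, zero_mcomp, one1_sh, sh_one1]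

lemma star_eG (c : Ser × Ser) : star c eG = c := by
  simp only [star_def, mcomp_eG]
  simp [eG, sh_one1, zero_sh]

lemma exists_left_inverse {c : Ser × Ser} (hc : inG c) : ∃ y, inG y ∧ star y c = eG := by
  obtain ⟨r, hr⟩ := exists_sh_inverse hc
  have h1 := mcomp_mcompPreimage hr r
  have h2 := mcomp_mcompPreimage hr (-sh c.2 r)
  refine ⟨(mcompPreimage r c r, mcompPreimage r c (-sh c.2 r)), ?_, ?_⟩
  · have hnil := congrFun hr []
    have hc' : c.1 [] = 1 := hc
    simpa [sh_nil, hc', one1, inG, mcompPreimage] using hnil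
  · simp [star_def, h1, h2, eG, sh_comm r, hr]

end Group

/-- `G` with the affine feedback product `c ⋆ d = (c ⊲ d) ⊙ d`
is a group with identity `e = (𝟙, 0)`: `⋆` is closed on `G`, associative,
`e` is a two-sided unit, and every element of `G` has a two-sided
`⋆`-inverse in `G`. -/
theorem star_group :
    (∀ c d : Ser × Ser, inG c → inG d → inG (star c d)) ∧
    inG eG ∧
    (∀ c d f : Ser × Ser, inG c → inG d → inG f →
      star (star c d) f = star c (star d f)) ∧
    (∀ c : Ser × Ser, inG c → star eG c = c ∧ star c eG = c) ∧
    (∀ c : Ser × Ser, inG c →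
      ∃ y : Ser × Ser, inG y ∧ star c y = eG ∧ star y c = eG) := by
  refine ⟨fun c d => inG_star, inG_eG, fun c d f _ _ _ => star_assoc c d f,
    fun c _ => ⟨eG_star c, star_eG c⟩, fun c hc => ?_⟩
  obtain ⟨y, hy, hyc⟩ := exists_left_inverse hc
  obtain ⟨z, -, hzy⟩ := exists_left_inverse hy
  have hz : z = c := by
    rw [← star_eG z, ← hyc, ← star_assoc, hzy, eG_star]
  exact ⟨y, hy, hz ▸ hzy, hyc⟩
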